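/- For every nonzero x in R^3 and all indices j, l, m in {1,2,3}, the stresslet admits the operator representation [ (δ_{jl} ∂_m + δ_{lm} ∂_j + δ_{mj} ∂_l) Δ − 2 ∂_j ∂_l ∂_m ] |x| = −6 x_j x_l x_m / |x|^5, where Δ is the Laplacian on R^3, ∂_j denotes the j-th partial derivative, and δ_{jl} is the Kronecker delta. -/

import Mathlib

open MeasureTheory Real Filter

noncomputable section

/-- Euclidean 3-space. -/
abbrev E3 := EuclideanSpace ℝ (Fin 3)

/-- Partial derivative in the `j`-th coordinate direction. -/
def pd (j : Fin 3) (f : E3 → ℝ) (x : E3) : ℝ :=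
  fderiv ℝ f x (EuclideanSpace.single j 1)

/-- Laplacian on `E3`. -/
def lap (f : E3 → ℝ) (x : E3) : ℝ :=
  ∑ i : Fin 3, pd i (pd i f) x

/-- Gauss error function. -/
def erf (t : ℝ) : ℝ := (2 / Real.sqrt π) * ∫ s in (0:ℝ)..t, Real.exp (-s ^ 2)

/-- Complementary error function. -/
def erfc (t : ℝ) : ℝ := 1 - erf t

/-- Kronecker delta on `Fin 3`. -/
def kron (j l : Fin 3) : ℝ := if j = l then 1 else 0

/-- Levi-Civita symbol on `Fin 3`. -/
def lev (j l m : Fin 3) : ℝ :=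
  ((l.val : ℝ) - (j.val : ℝ)) * ((m.val : ℝ) - (l.val : ℝ)) * ((m.val : ℝ) - (j.val : ℝ)) / 2

theorem pd_eq_of_hasFDerivAt {f : E3 → ℝ} {f' : E3 →L[ℝ] ℝ} {x : E3} (h : HasFDerivAt f f' x)
    (j : Fin 3) : pd j f x = f' (EuclideanSpace.single j 1) := by
  rw [pd, h.fderiv]

theorem pd_congr_of_ne_zero {f g : E3 → ℝ} (h : ∀ y, y ≠ 0 → f y = g y) {x : E3} (hx : x ≠ 0)
    (j : Fin 3) : pd j f x = pd j g x := by
  have hfg : f =ᶠ[nhds x] g := (eventually_ne_nhds hx).mono h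
  rw [pd, pd, hfg.fderiv_eq]

theorem kron_comm (j l : Fin 3) : kron j l = kron l j := by
  simp only [kron, eq_comm]

theorem hasFDerivAt_norm_of_ne_zero {x : E3} (hx : x ≠ 0) :
    HasFDerivAt (fun y : E3 => ‖y‖) (‖x‖⁻¹ • innerSL ℝ x) x := by
  have h := (hasStrictFDerivAt_norm_sq x).hasFDerivAt.sqrt (by positivity)
  simp only [Real.sqrt_sq (norm_nonneg _)] at h
  refine h.congr_fderiv ?_
  have hn : ‖x‖ ≠ 0 := norm_ne_zero_iff.mpr hx
  ext v
  simp
  field_simp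

theorem hasFDerivAt_norm_zpow {x : E3} (hx : x ≠ 0) (n : ℤ) :
    HasFDerivAt (fun y : E3 => ‖y‖ ^ n) ((n * ‖x‖ ^ (n - 2)) • innerSL ℝ x) x := by
  have hn : ‖x‖ ≠ 0 := norm_ne_zero_iff.mpr hx
  refine ((hasDerivAt_zpow n ‖x‖ (Or.inl hn)).comp_hasFDerivAt x
    (hasFDerivAt_norm_of_ne_zero hx)).congr_fderiv ?_
  rw [smul_smul, mul_assoc, ← zpow_sub_one₀ hn, sub_sub, one_add_one_eq_two]

theorem hasFDerivAt_coord (l : Fin 3) (x : E3) :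
    HasFDerivAt (fun y : E3 => y l) (EuclideanSpace.proj l : E3 →L[ℝ] ℝ) x :=
  (EuclideanSpace.proj l : E3 →L[ℝ] ℝ).hasFDerivAt

theorem coord_single (j l : Fin 3) : (EuclideanSpace.single j (1 : ℝ) : E3) l = kron j l := by
  simp [kron, eq_comm]

theorem pd_norm {x : E3} (hx : x ≠ 0) (m : Fin 3) :
    pd m (fun y => ‖y‖) x = x m * ‖x‖ ^ (-1 : ℤ) := by
  rw [pd_eq_of_hasFDerivAt (hasFDerivAt_norm_of_ne_zero hx)]
  simp [EuclideanSpace.inner_single_right, mul_comm]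

theorem pd_pd_norm {x : E3} (hx : x ≠ 0) (l m : Fin 3) :
    pd l (pd m (fun y => ‖y‖)) x =
      kron l m * ‖x‖ ^ (-1 : ℤ) - x l * x m * ‖x‖ ^ (-3 : ℤ) := by
  rw [pd_congr_of_ne_zero (fun y hy => pd_norm hy m) hx]
  refine (pd_eq_of_hasFDerivAt
    ((hasFDerivAt_coord m x).mul (hasFDerivAt_norm_zpow hx (-1))) l).trans ?_
  simp [EuclideanSpace.inner_single_right, coord_single, -PiLp.single_apply]
  ring

theorem pd_pd_pd_norm {x : E3} (hx : x ≠ 0) (j l m : Fin 3) :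
    pd j (pd l (pd m (fun y => ‖y‖))) x =
      -(kron j l * x m + kron l m * x j + kron m j * x l) * ‖x‖ ^ (-3 : ℤ)
        + 3 * (x j * x l * x m) * ‖x‖ ^ (-5 : ℤ) := by
  rw [pd_congr_of_ne_zero (fun y hy => pd_pd_norm hy l m) hx, kron_comm m j]
  refine (pd_eq_of_hasFDerivAt (((hasFDerivAt_norm_zpow hx (-1)).const_mul (kron l m)).sub
    (((hasFDerivAt_coord l x).mul (hasFDerivAt_coord m x)).mul
      (hasFDerivAt_norm_zpow hx (-3)))) j).trans ?_
  simp [EuclideanSpace.inner_single_right, coord_single, -PiLp.single_apply]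
  ring

theorem lap_norm {x : E3} (hx : x ≠ 0) : lap (fun y => ‖y‖) x = 2 * ‖x‖ ^ (-1 : ℤ) := by
  have hn : ‖x‖ ≠ 0 := norm_ne_zero_iff.mpr hx
  have hsq : ‖x‖ ^ 2 = x 0 ^ 2 + x 1 ^ 2 + x 2 ^ 2 := by
    simp [EuclideanSpace.real_norm_sq_eq, Fin.sum_univ_three]
  have hz : ‖x‖ ^ (-1 : ℤ) = ‖x‖ ^ 2 * ‖x‖ ^ (-3 : ℤ) := by
    rw [← zpow_natCast, ← zpow_add₀ hn]
    norm_num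
  simp only [lap, pd_pd_norm hx, Fin.sum_univ_three, kron, if_true]
  linear_combination ‖x‖ ^ (-3 : ℤ) * hsq + hz

theorem pd_lap_norm {x : E3} (hx : x ≠ 0) (m : Fin 3) :
    pd m (lap (fun y => ‖y‖)) x = -2 * x m * ‖x‖ ^ (-3 : ℤ) := by
  rw [pd_congr_of_ne_zero (fun y hy => lap_norm hy) hx,
    pd_eq_of_hasFDerivAt ((hasFDerivAt_norm_zpow hx (-1)).const_mul 2)]
  simp [EuclideanSpace.inner_single_right]
  ring

/-- Operator representation of the stresslet:
`[(δ_{jl}∂_m + δ_{lm}∂_j + δ_{mj}∂_l) Δ − 2 ∂_j ∂_l ∂_m] |x| = −6 x_j x_l x_m/|x|^5`. -/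
theorem stresslet_operator_form (x : E3) (hx : x ≠ 0) (j l m : Fin 3) :
    (kron j l * pd m (lap (fun y => ‖y‖)) x
        + kron l m * pd j (lap (fun y => ‖y‖)) x
        + kron m j * pd l (lap (fun y => ‖y‖)) x)
      - 2 * pd j (pd l (pd m (fun y => ‖y‖))) x
      = -6 * (x j * x l * x m) / ‖x‖ ^ 5 := by
  have h : ‖x‖ ^ (-5 : ℤ) = (‖x‖ ^ 5)⁻¹ := zpow_neg_coe_of_pos ‖x‖ (by norm_num)
  rw [pd_lap_norm hx, pd_lap_norm hx, pd_lap_norm hx, pd_pd_pd_norm hx, h, div_eq_mul_inv]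
  ring
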